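/- arXiv:1604.01461 — 2 statements merged into one kernel-verified Lean document; each statement's English description precedes it below -/
import Mathlib

section
/- Let X be a Banach space that is not reflexive and let Y be a nonzero Banach space (over the same field 𝕜 = ℝ or ℂ). Then the pair (X, Y) fails the strong Bishop-Phelps-Bollobás property; in fact, there exists a bounded linear operator T : X → Y with ‖T‖ = 1 such that ‖T x‖ < 1 for every x ∈ X with ‖x‖ = 1, i.e., T does not attain its norm. -/
/-- A pair of Banach spaces `(X, Y)` has the strong Bishop-Phelps-Bollobás property. -/
def SBPBp (𝕜 : Type*) [RCLike 𝕜] (X Y : Type*) [NormedAddCommGroup X] [NormedSpace 𝕜 X]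
    [NormedAddCommGroup Y] [NormedSpace 𝕜 Y] : Prop :=
  ∀ ε : ℝ, 0 < ε → ∀ T : X →L[𝕜] Y, ‖T‖ = 1 →
    ∃ η : ℝ, 0 < η ∧ ∀ x₀ : X, ‖x₀‖ = 1 → 1 - η < ‖T x₀‖ →
      ∃ x₁ : X, ‖x₁‖ = 1 ∧ ‖T x₁‖ = 1 ∧ ‖x₁ - x₀‖ < ε

open Filter Topology

/-- **Goldstine's theorem**, in the form of finite approximation of a bidual element by
elements of the unit ball. -/
theorem exists_norm_le_one_forall_norm_sub_lt {𝕜 E : Type*} [RCLike 𝕜] [NormedAddCommGroup E]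
    [NormedSpace 𝕜 E] (Φ : StrongDual 𝕜 (StrongDual 𝕜 E)) (hΦ : ‖Φ‖ ≤ 1)
    (s : Finset (StrongDual 𝕜 E)) {ε : ℝ} (hε : 0 < ε) :
    ∃ x : E, ‖x‖ ≤ 1 ∧ ∀ f ∈ s, ‖f x - Φ f‖ < ε := by
  let _ : NormedSpace ℝ E := NormedSpace.restrictScalars ℝ 𝕜 E
  have : IsScalarTower ℝ 𝕜 E := IsScalarTower.of_algebraMap_smul fun _ _ => rfl
  classical
  let L : E →L[𝕜] (s → 𝕜) := ContinuousLinearMap.pi fun f => f.1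
  let v : s → 𝕜 := fun f => Φ f.1
  have hconv : Convex ℝ (L '' Metric.closedBall 0 1) :=
    (convex_closedBall (0 : E) 1).is_linear_image (L.restrictScalars ℝ).toLinearMap.isLinear
  by_cases hv : v ∈ closure (L '' Metric.closedBall 0 1)
  · obtain ⟨_, ⟨x, hx, rfl⟩, hxv⟩ := Metric.mem_closure_iff.1 hv ε hε
    refine ⟨x, by simpa using hx, fun f hf => ?_⟩
    rw [dist_comm, dist_pi_lt_iff hε] at hxv
    simpa [dist_eq_norm, L, v] using hxv ⟨f, hf⟩
  · exfalso
    obtain ⟨h, u, hlt, hu⟩ :=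
      RCLike.geometric_hahn_banach_closed_point (𝕜 := 𝕜) hconv.closure isClosed_closure hv
    have happ : ∀ a : s → 𝕜, h a = ∑ f, a f * h (Pi.single f 1) := fun a => by
      conv_lhs => rw [pi_eq_sum_univ' a, map_sum]
      refine Finset.sum_congr rfl fun f _ => ?_
      rw [map_smul, smul_eq_mul]
    let g : StrongDual 𝕜 E := ∑ f : s, h (Pi.single f 1) • f.1
    have hg : ∀ x, g x = h (L x) := fun x => by
      rw [happ (L x)]
      simp [g, L, mul_comm]
    have hΦg : Φ g = h v := by
      rw [happ v]
      simp [g, v, mul_comm]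
    have hre : ∀ x : E, ‖x‖ ≤ 1 → RCLike.re (g x) < u := fun x hx => by
      rw [hg]
      exact hlt _ (subset_closure ⟨x, by simpa using hx, rfl⟩)
    have hu0 : 0 < u := by simpa using hre 0 (by simp)
    have hgu : ‖g‖ ≤ u := by
      refine ContinuousLinearMap.opNorm_le_of_unit_norm hu0.le fun x hx => ?_
      obtain ⟨c, hc, hcx⟩ := RCLike.exists_norm_eq_mul_self (g x)
      have := hre (c • x) (by rw [norm_smul, hc, hx, one_mul])
      rw [map_smul, smul_eq_mul, ← hcx, RCLike.ofReal_re] at this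
      exact this.le
    have h1 : RCLike.re (h v) ≤ ‖g‖ :=
      calc RCLike.re (h v) ≤ ‖Φ g‖ := hΦg ▸ RCLike.re_le_norm _
        _ ≤ ‖Φ‖ * ‖g‖ := Φ.le_opNorm g
        _ ≤ ‖g‖ := mul_le_of_le_one_left (norm_nonneg _) hΦ
    linarith

/-- A non-surjective isometric embedding of a Banach space has a functional vanishing on its range
and not vanishing on some vector of norm at most one. -/
theorem exists_dual_pos_of_not_surjective_of_norm_map {𝕜 X V : Type*} [RCLike 𝕜]
    [NormedAddCommGroup X] [NormedSpace 𝕜 X] [CompleteSpace X] [NormedAddCommGroup V]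
    [NormedSpace 𝕜 V] (J : X →ₗ[𝕜] V) (hnorm : ∀ x, ‖J x‖ = ‖x‖)
    (hJ : ¬ Function.Surjective J) :
    ∃ (v : V) (g : StrongDual 𝕜 V), ‖v‖ ≤ 1 ∧ ‖g‖ ≤ 1 ∧ (∀ x, g (J x) = 0) ∧
      0 < RCLike.re (g v) := by
  let p : Submodule 𝕜 V := J.range
  have hp : (p : Set V) = Set.range J := by
    ext; simp [p]
  have hcl : IsClosed (p : Set V) := by
    rw [hp]; exact (AddMonoidHomClass.isometry_of_norm J hnorm).isClosedEmbedding.isClosed_range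
  obtain ⟨v, hv⟩ : ∃ v, v ∉ p := by
    by_contra! h
    exact hJ h
  wlog hv1 : ‖v‖ ≤ 1 generalizing v
  · have hv0 : ((‖v‖⁻¹ : ℝ) : 𝕜) ≠ 0 := by
      simp only [ne_eq, RCLike.ofReal_eq_zero, inv_eq_zero]
      intro h; rw [h] at hv1; norm_num at hv1
    refine this (((‖v‖⁻¹ : ℝ) : 𝕜) • v) (fun h => hv ((p.smul_mem_iff hv0).1 h)) ?_
    rw [norm_smul, RCLike.norm_ofReal, abs_of_nonneg (by positivity)]
    exact inv_mul_le_one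
  have hq : p.mkQ v ≠ 0 := by
    rwa [Submodule.mkQ_apply, ne_eq, Submodule.Quotient.mk_eq_zero]
  obtain ⟨g, hg1, hg⟩ := exists_dual_vector 𝕜 (p.mkQ v) (norm_ne_zero_iff.2 hq)
  refine ⟨v, g.comp p.mkQL, hv1, ?_, fun x => ?_, ?_⟩
  · refine ContinuousLinearMap.opNorm_le_bound _ zero_le_one fun w => ?_
    calc ‖g (p.mkQ w)‖ ≤ ‖g‖ * ‖p.mkQ w‖ := g.le_opNorm _
      _ ≤ 1 * ‖w‖ := by rw [hg1]; gcongr; exact Submodule.Quotient.norm_mk_le p w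
  · have : p.mkQ (J x) = 0 := by simp [p]
    change g (p.mkQ (J x)) = 0
    rw [this, map_zero]
  · change 0 < RCLike.re (g (p.mkQ v))
    rw [hg, RCLike.ofReal_re]
    exact norm_pos_iff.2 hq

/-- In a non-reflexive Banach space there are sequences in the unit balls of the dual and of the
space on which the evaluation pairing is large above the diagonal and small below it. -/
theorem exists_seq_of_not_surjective_inclusionInDoubleDual {𝕜 X : Type*} [RCLike 𝕜]
    [NormedAddCommGroup X] [NormedSpace 𝕜 X] [CompleteSpace X]
    (hX : ¬ Function.Surjective (NormedSpace.inclusionInDoubleDual 𝕜 X)) :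
    ∃ c > 0, ∃ (f : ℕ → StrongDual 𝕜 X) (x : ℕ → X), (∀ n, ‖f n‖ ≤ 1) ∧ (∀ n, ‖x n‖ ≤ 1) ∧
      (∀ m n, m ≤ n → 3 * c ≤ RCLike.re (f m (x n))) ∧
      ∀ m n, m < n → RCLike.re (f n (x m)) ≤ c := by
  classical
  have hnorm : ∀ x : X, ‖NormedSpace.inclusionInDoubleDual 𝕜 X x‖ = ‖x‖ :=
    (NormedSpace.inclusionInDoubleDualLi 𝕜 (E := X)).norm_map
  have hexists := @exists_dual_pos_of_not_surjective_of_norm_map 𝕜 X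
    (StrongDual 𝕜 (StrongDual 𝕜 X)) _ _ _ _ _ _ (NormedSpace.inclusionInDoubleDual 𝕜 X)
  obtain ⟨F, G, hF1, hG1, hGJ, hpos⟩ := hexists hnorm hX
  let J := NormedSpace.inclusionInDoubleDual 𝕜 X
  have hGJ' : ∀ x, G (J x) = 0 := hGJ
  obtain ⟨c, hc, hcF⟩ : ∃ c > 0, 5 * c = RCLike.re (G F) :=
    ⟨RCLike.re (G F) / 5, by positivity, by ring⟩
  have re_sub : ∀ {a b : 𝕜} {e : ℝ}, ‖a - b‖ < e →
      RCLike.re a < RCLike.re b + e ∧ RCLike.re b - e < RCLike.re a := fun {a b e} h => by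
    have := abs_lt.1 ((RCLike.abs_re_le_norm (a - b)).trans_lt h)
    rw [map_sub] at this
    constructor <;> linarith
  obtain ⟨z, hz, hzr⟩ := exists_seq_of_forall_finset_exists
    (α := StrongDual 𝕜 X × X)
    (fun z => ‖z.1‖ ≤ 1 ∧ ‖z.2‖ ≤ 1 ∧ 4 * c ≤ RCLike.re (F z.1) ∧ 3 * c ≤ RCLike.re (z.1 z.2))
    (fun z w => 3 * c ≤ RCLike.re (z.1 w.2) ∧ RCLike.re (w.1 z.2) ≤ c) (fun s hs => by
      obtain ⟨f, hf1, hf⟩ := exists_norm_le_one_forall_norm_sub_lt G hG1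
        (insert F (s.image fun z => J z.2)) hc
      have hfF : 4 * c ≤ RCLike.re (F f) := by
        have := (re_sub (hf F (by simp))).2
        linarith
      obtain ⟨y, hy1, hy⟩ := exists_norm_le_one_forall_norm_sub_lt F hF1
        (insert f (s.image Prod.fst)) hc
      refine ⟨(f, y), ⟨hf1, hy1, hfF, ?_⟩, fun z hz => ⟨?_, ?_⟩⟩
      · have := (re_sub (hy f (by simp))).2
        dsimp only
        linarith
      · have := (re_sub (hy z.1 (Finset.mem_insert_of_mem (Finset.mem_image_of_mem _ hz)))).2
        have := (hs z hz).2.2.1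
        dsimp only
        linarith
      · have := (re_sub (hf (J z.2)
          (Finset.mem_insert_of_mem (Finset.mem_image.2 ⟨z, hz, rfl⟩)))).1
        rw [hGJ', map_zero, zero_add] at this
        exact this.le)
  refine ⟨c, hc, fun n => (z n).1, fun n => (z n).2, fun n => (hz n).1, fun n => (hz n).2.1,
    fun m n hmn => ?_, fun m n hmn => (hzr m n hmn).2⟩
  rcases hmn.eq_or_lt with rfl | h
  · exact (hz m).2.2.2
  · exact (hzr m n h).1

/-- Below any element of a preorder in which decreasing sequences are bounded below, countably many
antitone bounded functions can be made simultaneously stationary. -/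
theorem exists_le_forall_le_of_antitone {P : Type*} [Preorder P]
    (hP : ∀ u : ℕ → P, Antitone u → ∃ p, ∀ n, p ≤ u n) (T : ℕ → P → ℝ)
    (hT : ∀ i, Antitone (T i)) (hbdd : ∀ i, BddAbove (Set.range (T i))) (p₀ : P) :
    ∃ p ≤ p₀, ∀ q ≤ p, ∀ i, T i q ≤ T i p := by
  have step : ∀ (i : ℕ) (ε : ℝ), 0 < ε → ∀ p : P, ∃ q ≤ p, ∀ q' ≤ p, T i q' ≤ T i q + ε := by
    intro i ε hε p
    have hne : (T i '' Set.Iic p).Nonempty := ⟨_, p, le_refl p, rfl⟩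
    obtain ⟨_, ⟨q, hq, rfl⟩, hlt⟩ := exists_lt_of_lt_csSup hne (sub_lt_self (sSup _) hε)
    refine ⟨q, hq, fun q' hq' => ?_⟩
    have := le_csSup ((hbdd i).mono (Set.image_subset_range _ (Set.Iic p)))
      (Set.mem_image_of_mem _ hq')
    linarith
  choose! next hnext hmax using step
  let ε : ℕ → ℝ := fun k => 1 / ((Nat.unpair k).2 + 1)
  have hε : ∀ k, 0 < ε k := fun k => by positivity
  let u : ℕ → P := fun n => Nat.rec p₀ (fun k p => next (Nat.unpair k).1 (ε k) p) n
  have hu : Antitone u := antitone_nat_of_succ_le fun k => hnext _ _ (hε k) _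
  obtain ⟨p, hp⟩ := hP u hu
  refine ⟨p, hp 0, fun q hq i => le_of_forall_pos_le_add fun δ hδ => ?_⟩
  obtain ⟨m, hm⟩ := exists_nat_one_div_lt hδ
  have h1 := hmax (Nat.unpair (Nat.pair i m)).1 _ (hε (Nat.pair i m)) (u (Nat.pair i m)) q
    (hq.trans (hp _))
  have h2 := hT i (hp (Nat.pair i m + 1))
  have h3 : u (Nat.pair i m + 1) =
    next (Nat.unpair (Nat.pair i m)).1 (ε (Nat.pair i m)) (u (Nat.pair i m)) := rfl
  rw [h3] at h2
  simp only [ε, Nat.unpair_pair] at h1 h2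
  linarith

/-- From a decreasing sequence of convex sets bounded away from `0`, one can select points whose
geometrically weighted sums approach their limiting norm `α` at a controlled rate. -/
theorem exists_seq_norm_sum_le {E : Type*} [NormedAddCommGroup E] [NormedSpace ℝ E]
    {K : ℕ → Set E} (hK : Antitone K) (hconv : ∀ n, Convex ℝ (K n)) (hne : ∀ n, (K n).Nonempty)
    {θ M r : ℝ} (hθ : 0 < θ) (hr : 0 < r) (hr1 : r < 1) (hlow : ∀ z ∈ K 0, θ ≤ ‖z‖)
    (hM : ∀ z ∈ K 0, ‖z‖ ≤ M) :
    ∃ z : ℕ → E, (∀ n, z n ∈ K n) ∧ ∃ α ≥ θ,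
      Tendsto (fun n => ‖∑ i ∈ Finset.range n, ((1 - r) * r ^ i) • z i‖) atTop (𝓝 α) ∧
      ∀ n, ‖∑ i ∈ Finset.range n, ((1 - r) * r ^ i) • z i‖ ≤ α * (1 - r ^ n / 2) := by
  let ε : ℕ → ℝ := fun n => θ * (r ^ (n + 1) * (1 / 2) ^ (n + 2))
  have hε : ∀ n, 0 < ε n := fun n => by positivity
  have step : ∀ (n : ℕ) (s : E), ∃ z ∈ K n, ∀ y ∈ K n, ‖s + r ^ n • z‖ ≤ ‖s + r ^ n • y‖ + ε n := by
    intro n s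
    let A := (fun y => ‖s + r ^ n • y‖) '' K n
    obtain ⟨_, ⟨z, hz, rfl⟩, hlt⟩ := exists_lt_of_csInf_lt ((hne n).image _)
      (lt_add_of_pos_right (sInf A) (hε n))
    refine ⟨z, hz, fun y hy => hlt.le.trans ?_⟩
    gcongr
    exact csInf_le ⟨0, by rintro _ ⟨y, -, rfl⟩; exact norm_nonneg _⟩ ⟨y, hy, rfl⟩
  choose sel hselK hsel using step
  let S : ℕ → E := fun n => Nat.rec 0 (fun k s => s + ((1 - r) * r ^ k) • sel k s) n
  let z : ℕ → E := fun n => sel n (S n)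
  have hSs : ∀ n, S (n + 1) = S n + ((1 - r) * r ^ n) • z n := fun n => rfl
  have hS : ∀ n, ∑ i ∈ Finset.range n, ((1 - r) * r ^ i) • z i = S n := fun n => by
    induction n with
    | zero => rfl
    | succ n ih => rw [Finset.sum_range_succ, ih, hSs]
  have hzK : ∀ n, z n ∈ K n := fun n => hselK n _
  have hmin : ∀ n, ∀ y ∈ K n, ‖S n + r ^ n • z n‖ ≤ ‖S n + r ^ n • y‖ + ε n :=
    fun n => hsel n (S n)
  have hrep : ∀ n m, n ≤ m → ∀ y ∈ K m, ∃ v ∈ K n, S m + r ^ m • y = S n + r ^ n • v := by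
    intro n m hnm
    induction m, hnm using Nat.le_induction with
    | base => exact fun y hy => ⟨y, hy, rfl⟩
    | succ m hm ih =>
      intro y hy
      obtain ⟨v, hv, hvS⟩ := ih ((1 - r) • z m + r • y)
        (hconv m (hzK m) (hK m.le_succ hy) (by linarith) hr.le (by ring))
      refine ⟨v, hv, hvS ▸ ?_⟩
      rw [hSs]
      module
  have hK0 : ∀ n, z n ∈ K 0 := fun n => hK (Nat.zero_le n) (hzK n)
  have hM0 : 0 ≤ M := (norm_nonneg _).trans (hM _ (hK0 0))
  have hdist : ∀ n, dist (S n) (S (n + 1)) ≤ ((1 - r) * M) * r ^ n := fun n => by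
    rw [dist_comm, dist_eq_norm, hSs, add_sub_cancel_left, norm_smul, Real.norm_of_nonneg
      (mul_nonneg (by linarith) (by positivity))]
    have := mul_le_mul_of_nonneg_left (hM _ (hK0 n))
      (mul_nonneg (sub_nonneg.2 hr1.le) (pow_nonneg hr.le n))
    linarith
  have hcauchy : CauchySeq fun n => ‖S n‖ :=
    uniformContinuous_norm.comp_cauchySeq (cauchySeq_of_le_geometric r _ hr1 hdist)
  obtain ⟨α, hα⟩ := cauchySeq_tendsto_of_complete hcauchy
  have hrn : Tendsto (fun n => r ^ n * M) atTop (𝓝 0) := by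
    simpa using (tendsto_pow_atTop_nhds_zero_of_lt_one hr.le hr1).mul_const M
  have hnorm : ∀ n, ‖r ^ n • z n‖ ≤ r ^ n * M := fun n => by
    rw [norm_smul, Real.norm_of_nonneg (by positivity)]
    gcongr
    exact hM _ (hK0 n)
  have hub : ∀ m, ‖S m + r ^ m • z m‖ ≤ ‖S m‖ + r ^ m * M := fun m =>
    (norm_add_le _ _).trans (by gcongr; exact hnorm m)
  have hlim : Tendsto (fun n => ‖S n‖ + r ^ n * M) atTop (𝓝 α) := by simpa using hα.add hrn
  have hθα : θ ≤ α := by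
    refine ge_of_tendsto' hlim fun m => le_trans ?_ (hub m)
    obtain ⟨v, hv, h⟩ := hrep 0 m (Nat.zero_le m) _ (hzK m)
    have hv' : S m + r ^ m • z m = v := by rw [h]; simp [S]
    rw [hv']
    exact hlow v hv
  have huα : ∀ n, ‖S n + r ^ n • z n‖ ≤ α + ε n := by
    refine fun n => ge_of_tendsto (hlim.add_const (ε n)) ?_
    filter_upwards [eventually_ge_atTop n] with m hm
    obtain ⟨v, hv, h⟩ := hrep n m hm _ (hzK m)
    have h1 := hmin n v hv
    rw [← h] at h1
    linarith [hub m]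
  have hα0 : 0 < α := hθ.trans_le hθα
  have key : ∀ n, ‖S n‖ ≤ α * (1 - r ^ n * (1 / 2 + (1 / 2) ^ (n + 1))) := fun n => by
    induction n with
    | zero => simp [S]; norm_num
    | succ n ih =>
      have h1 : S (n + 1) = (1 - r) • (S n + r ^ n • z n) + r • S n := by rw [hSs]; module
      have h2 : ‖S (n + 1)‖ ≤ (1 - r) * ‖S n + r ^ n • z n‖ + r * ‖S n‖ := by
        rw [h1]
        refine (norm_add_le _ _).trans_eq ?_
        rw [norm_smul, norm_smul, Real.norm_of_nonneg hr.le, Real.norm_of_nonneg (by linarith)]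
      have h3 : (1 - r) * ‖S n + r ^ n • z n‖ ≤ (1 - r) * (α + ε n) :=
        mul_le_mul_of_nonneg_left (huα n) (by linarith)
      have h4 := mul_le_mul_of_nonneg_left ih hr.le
      have h5 : (1 - r) * ε n ≤ α * (r ^ (n + 1) * (1 / 2) ^ (n + 2)) := by
        calc (1 - r) * ε n ≤ 1 * ε n := mul_le_mul_of_nonneg_right (by linarith) (hε n).le
          _ ≤ _ := by rw [one_mul]; simp only [ε]; gcongr
      have h6 : α * (1 - r ^ (n + 1) * (1 / 2 + (1 / 2) ^ (n + 1 + 1))) =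
          (1 - r) * α + α * (r ^ (n + 1) * (1 / 2) ^ (n + 2)) +
            r * (α * (1 - r ^ n * (1 / 2 + (1 / 2) ^ (n + 1)))) := by ring
      linarith
  refine ⟨z, hzK, α, hθα, by simpa only [hS] using hα, fun n => ?_⟩
  rw [hS]
  refine (key n).trans ?_
  gcongr
  have : 0 ≤ r ^ n * (1 / 2) ^ (n + 1) := by positivity
  linarith

section

variable {X : Type*} [NormedAddCommGroup X] [NormedSpace ℝ X]

theorem StrongDual.apply_le_norm (g : StrongDual ℝ X) {x : X} (hx : ‖x‖ ≤ 1) : g x ≤ ‖g‖ :=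
  (le_abs_self _).trans ((g.le_opNorm x).trans (mul_le_of_le_one_right (norm_nonneg _) hx))

/-- The functionals lying pointwise between the lower and upper limits of `f` along `l`. -/
def limitFunctionals (f : ℕ → StrongDual ℝ X) (l : Filter ℕ) : Set (StrongDual ℝ X) :=
  {w | ∀ x a, (∀ᶠ n in l, f n x ≤ a) → w x ≤ a}

theorem limitFunctionals_mono (f : ℕ → StrongDual ℝ X) {l l' : Filter ℕ} (h : l ≤ l') :
    limitFunctionals f l ⊆ limitFunctionals f l' :=
  fun _ hw x a ha => hw x a (h ha)

theorem frequently_le_add_of_mem_limitFunctionals {f : ℕ → StrongDual ℝ X} {l : Filter ℕ}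
    {w : StrongDual ℝ X} (hw : w ∈ limitFunctionals f l) (x : X) {ε : ℝ} (hε : 0 < ε) :
    ∃ᶠ n in l, f n x ≤ w x + ε := by
  intro h
  have := hw (-x) (-(w x + ε)) (h.mono fun n hn => by
    rw [map_neg]
    linarith [not_le.1 hn])
  rw [map_neg] at this
  linarith

theorem norm_le_one_of_mem_limitFunctionals {f : ℕ → StrongDual ℝ X} (hf : ∀ n, ‖f n‖ ≤ 1)
    {l : Filter ℕ} {w : StrongDual ℝ X} (hw : w ∈ limitFunctionals f l) : ‖w‖ ≤ 1 := by
  have h : ∀ x, w x ≤ ‖x‖ := fun x => hw x _ (Eventually.of_forall fun n =>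
    (le_abs_self _).trans (((f n).le_opNorm x).trans
      (mul_le_of_le_one_left (norm_nonneg _) (hf n))))
  refine ContinuousLinearMap.opNorm_le_bound _ zero_le_one fun x => ?_
  rw [one_mul, Real.norm_eq_abs, abs_le]
  refine ⟨?_, h x⟩
  have := h (-x)
  rw [map_neg, norm_neg] at this
  linarith

theorem limitFunctionals_nonempty {f : ℕ → StrongDual ℝ X} (hf : ∀ n, ‖f n‖ ≤ 1) (l : Filter ℕ)
    [l.NeBot] : (limitFunctionals f l).Nonempty := by
  let U := Ultrafilter.of l
  let F : ℕ → WeakDual ℝ X := fun n => StrongDual.toWeakDual (f n)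
  obtain ⟨w, -, hw⟩ := (WeakDual.isCompact_closedBall (𝕜 := ℝ) (0 : StrongDual ℝ X) 1)
    |>.ultrafilter_le_nhds (U.map F) (by
      rw [le_principal_iff, Ultrafilter.coe_map, mem_map]
      exact univ_mem' fun n => by simpa [F] using hf n)
  refine ⟨WeakDual.toStrongDual w, fun x a ha => ?_⟩
  have hlim : Tendsto (fun n => f n x) U (𝓝 (w x)) :=
    ((WeakDual.eval_continuous x).tendsto w).comp (show Tendsto F U (𝓝 w) from hw)
  exact le_of_tendsto hlim (Ultrafilter.of_le l ha)

/-- A bounded sequence of functionals has a countably generated filter along which all limit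
functionals are equidistant from every element of the closed span of the sequence. -/
theorem exists_filter_forall_norm_sub_eq {f : ℕ → StrongDual ℝ X} (hf : ∀ n, ‖f n‖ ≤ 1) :
    ∃ l : Filter ℕ, l.NeBot ∧ l.IsCountablyGenerated ∧ l ≤ atTop ∧
      ∀ w ∈ limitFunctionals f l, ∀ w' ∈ limitFunctionals f l,
        ∀ g ∈ Submodule.span ℝ (Set.range f), ‖g - w‖ = ‖g - w'‖ := by
  obtain ⟨D, -, hDc, hD⟩ :=
    ((Set.countable_range f).isSeparable.span (R := ℝ)).exists_countable_dense_subset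
  have hDne : D.Nonempty := by
    rw [Set.nonempty_iff_ne_empty]
    rintro rfl
    simpa using hD (Submodule.zero_mem _)
  obtain ⟨d, rfl⟩ := hDc.exists_eq_range hDne
  let P := {l : Filter ℕ // l.NeBot ∧ l.IsCountablyGenerated ∧ l ≤ atTop}
  let A : ℕ → P → Set ℝ := fun i l => (fun w => ‖d i - w‖) '' limitFunctionals f l.1
  have hbelow : ∀ i l, BddBelow (A i l) :=
    fun i l => ⟨0, by rintro _ ⟨w, -, rfl⟩; exact norm_nonneg _⟩
  have hne : ∀ i l, (A i l).Nonempty := fun i l =>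
    have := l.2.1
    (limitFunctionals_nonempty hf l.1).image _
  obtain ⟨p, -, hp⟩ := exists_le_forall_le_of_antitone (P := P) (fun u hu => by
      refine ⟨⟨⨅ n, (u n).1, ?_, ?_, (iInf_le _ 0).trans (u 0).2.2.2⟩,
        fun n => iInf_le (fun n => (u n).1) n⟩
      · exact iInf_neBot_of_directed (directed_of_isDirected_le fun i j hij => hu hij)
          fun n => (u n).2.1
      · have : ∀ n, (u n).1.IsCountablyGenerated := fun n => (u n).2.2.1
        infer_instance)
    (fun i l => sInf (A i l))
    (fun i l l' h => csInf_le_csInf (hbelow i l') (hne i l)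
      (Set.image_mono (limitFunctionals_mono f h)))
    (fun i => ⟨‖d i‖ + 1, by
      rintro _ ⟨l, rfl⟩
      obtain ⟨_, w, hw, rfl⟩ := hne i l
      refine (csInf_le (hbelow i l) ⟨w, hw, rfl⟩).trans ((norm_sub_le _ _).trans ?_)
      gcongr
      exact norm_le_one_of_mem_limitFunctionals hf hw⟩)
    ⟨atTop, inferInstance, inferInstance, le_rfl⟩
  have hle : ∀ w ∈ limitFunctionals f p.1, ∀ i, ‖d i - w‖ ≤ sInf (A i p) := by
    intro w hw i
    have hreal : ∀ x : X, ‖x‖ ≤ 1 → (d i - w) x ≤ sInf (A i p) := by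
      intro x hx
      refine le_of_forall_pos_le_add fun ε hε => ?_
      have := p.2.2.1
      let q : P := ⟨p.1 ⊓ 𝓟 {n | f n x ≤ w x + ε},
        frequently_mem_iff_neBot.1 (frequently_le_add_of_mem_limitFunctionals hw x hε),
        inferInstance, inf_le_left.trans p.2.2.2⟩
      have h1 : sInf (A i q) ≤ sInf (A i p) := hp q (inf_le_left : q.1 ≤ p.1) i
      have h2 : (d i - w) x - ε ≤ sInf (A i q) := by
        refine le_csInf (hne i q) ?_
        rintro _ ⟨v, hv, rfl⟩
        have h3 : v x ≤ w x + ε := hv x _ (mem_inf_of_right (mem_principal_self _))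
        have h4 : (d i - v) x ≤ ‖d i - v‖ := StrongDual.apply_le_norm _ hx
        simp only [sub_apply] at h4 ⊢
        linarith
      linarith
    refine ContinuousLinearMap.opNorm_le_of_unit_norm (by simpa using hreal 0 (by simp))
      fun x hx => ?_
    rw [Real.norm_eq_abs, abs_le]
    refine ⟨?_, hreal x hx.le⟩
    have := hreal (-x) (by rw [norm_neg, hx])
    rw [map_neg] at this
    linarith
  have heq : ∀ w ∈ limitFunctionals f p.1, ∀ i, ‖d i - w‖ = sInf (A i p) :=
    fun w hw i => (hle w hw i).antisymm (csInf_le (hbelow i p) ⟨w, hw, rfl⟩)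
  refine ⟨p.1, p.2.1, p.2.2.1, p.2.2.2, fun w hw w' hw' g hg => ?_⟩
  have hcl : IsClosed {g : StrongDual ℝ X | ‖g - w‖ = ‖g - w'‖} :=
    isClosed_eq (by fun_prop) (by fun_prop)
  refine closure_minimal ?_ hcl (hD hg)
  rintro _ ⟨i, rfl⟩
  exact (heq w hw i).trans (heq w' hw' i).symm

/-- **James' construction**: a sequence of functionals whose convex hull stays away from its limit
functionals yields a functional that does not attain its norm. -/
theorem exists_dual_forall_lt_norm {f : ℕ → StrongDual ℝ X} (hf : ∀ n, ‖f n‖ ≤ 1) {θ : ℝ}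
    (hθ : 0 < θ) (hdist : ∀ w ∈ limitFunctionals f atTop, ∀ g ∈ convexHull ℝ (Set.range f),
      θ ≤ ‖g - w‖) :
    ∃ φ : StrongDual ℝ X, ∀ x, ‖x‖ ≤ 1 → φ x < ‖φ‖ := by
  obtain ⟨l, hl, hlc, hltop, hstab⟩ := exists_filter_forall_norm_sub_eq hf
  obtain ⟨w, hw⟩ := limitFunctionals_nonempty hf l
  obtain ⟨A, hA⟩ := l.exists_antitone_basis
  have hball : convexHull ℝ (Set.range f) ⊆ Metric.closedBall 0 1 :=
    convexHull_min (by rintro _ ⟨n, rfl⟩; simpa using hf n) (convex_closedBall _ _)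
  have hsub : ∀ n, convexHull ℝ (f '' A n) ⊆ convexHull ℝ (Set.range f) :=
    fun n => convexHull_mono (Set.image_subset_range _ _)
  have hdiff : ∀ v ∈ limitFunctionals f l, ∀ g ∈ convexHull ℝ (Set.range f), ‖g - v‖ ≤ 2 := by
    intro v hv g hg
    have h1 : ‖g‖ ≤ 1 := by simpa using hball hg
    linarith [norm_sub_le g v, norm_le_one_of_mem_limitFunctionals hf hv]
  have hθ2 : θ ≤ 2 := by
    have h0 : f 0 ∈ convexHull ℝ (Set.range f) := subset_convexHull _ _ ⟨0, rfl⟩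
    exact (hdist w (limitFunctionals_mono f hltop hw) _ h0).trans (hdiff w hw _ h0)
  obtain ⟨r, hr⟩ : ∃ r, r = θ / 16 := ⟨_, rfl⟩
  have hr0 : 0 < r := by rw [hr]; positivity
  have hr1 : r < 1 := by linarith
  obtain ⟨z, hzK, α, hα, hlim, hbd⟩ := exists_seq_norm_sum_le
    (K := fun n => (fun z => z + w) ⁻¹' convexHull ℝ (f '' A n))
    (fun m n hmn => Set.preimage_mono (convexHull_mono (Set.image_mono (hA.antitone hmn))))
    (fun n => (convex_convexHull ℝ _).translate_preimage_left w)
    (fun n => by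
      obtain ⟨k, hk⟩ := hl.nonempty_of_mem (hA.mem n)
      exact ⟨f k - w, by simpa using subset_convexHull ℝ _ (Set.mem_image_of_mem f hk)⟩)
    (M := 2) hθ hr0 hr1
    (fun z hz => by simpa using hdist w (limitFunctionals_mono f hltop hw) _ (hsub 0 hz))
    (fun z hz => by simpa using hdiff w hw _ (hsub 0 hz))
  let y : ℕ → StrongDual ℝ X := fun n => z n + w
  have hyA : ∀ n, y n ∈ convexHull ℝ (f '' A n) := hzK
  have hyball : ∀ n, ‖y n‖ ≤ 1 := fun n => by simpa using hball (hsub n (hyA n))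
  obtain ⟨w', hw'⟩ := limitFunctionals_nonempty hyball atTop
  have hw'l : w' ∈ limitFunctionals f l := by
    intro x a ha
    obtain ⟨N, hN⟩ := hA.mem_iff.1 ha
    refine hw' x a ?_
    filter_upwards [eventually_ge_atTop N] with n hn
    have hhalf : Convex ℝ {g : StrongDual ℝ X | g x ≤ a} :=
      convex_halfSpace_le (f := fun g : StrongDual ℝ X => g x)
        ⟨fun _ _ => rfl, fun _ _ => rfl⟩ a
    refine convexHull_min ?_ hhalf (hyA n)
    rintro _ ⟨k, hk, rfl⟩
    exact hN (hA.antitone hn hk)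
  let S : ℕ → StrongDual ℝ X := fun n => ∑ i ∈ Finset.range n, ((1 - r) * r ^ i) • (y i - w')
  have hweight : ∀ n, ∑ i ∈ Finset.range n, (1 - r) * r ^ i = 1 - r ^ n := fun n => by
    rw [← Finset.mul_sum, mul_comm]
    linarith [geom_sum_mul r n]
  have hspan : ∀ n, y n ∈ Submodule.span ℝ (Set.range f) := fun n =>
    convexHull_min Submodule.subset_span (Submodule.convex _) (hsub n (hyA n))
  have hSnorm : ∀ n, ‖S n‖ = ‖∑ i ∈ Finset.range n, ((1 - r) * r ^ i) • z i‖ := by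
    intro n
    rcases n.eq_zero_or_pos with rfl | hn
    · simp [S]
    have hpos : 0 < 1 - r ^ n := sub_pos.2 (pow_lt_one₀ hr0.le hr1 hn.ne')
    let g := (1 - r ^ n)⁻¹ • ∑ i ∈ Finset.range n, ((1 - r) * r ^ i) • y i
    have hg : g ∈ Submodule.span ℝ (Set.range f) := Submodule.smul_mem _ _
      (Submodule.sum_mem _ fun i _ => Submodule.smul_mem _ _ (hspan i))
    have hexp : ∀ v : StrongDual ℝ X,
        ∑ i ∈ Finset.range n, ((1 - r) * r ^ i) • (y i - v) = (1 - r ^ n) • (g - v) := by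
      intro v
      simp only [smul_sub, Finset.sum_sub_distrib, ← Finset.sum_smul, hweight]
      rw [smul_inv_smul₀ hpos.ne']
    have hz : ∀ i, z i = y i - w := fun i => (add_sub_cancel_right _ _).symm
    simp only [S, hz, hexp, norm_smul, hstab w hw w' hw'l g hg]
  have hSs : ∀ n, S (n + 1) = S n + ((1 - r) * r ^ n) • (y n - w') :=
    fun n => Finset.sum_range_succ _ _
  have hd2 : ∀ n, ‖y n - w'‖ ≤ 2 := fun n => hdiff w' hw'l _ (hsub n (hyA n))
  have hweight0 : ∀ n, 0 ≤ (1 - r) * r ^ n := fun n => mul_nonneg (by linarith) (by positivity)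
  obtain ⟨φ, hφ⟩ := cauchySeq_tendsto_of_complete
    (cauchySeq_of_le_geometric (f := S) r ((1 - r) * 2) hr1 fun n => by
      rw [dist_comm, dist_eq_norm, hSs, add_sub_cancel_left, norm_smul,
        Real.norm_of_nonneg (hweight0 n)]
      linarith [mul_le_mul_of_nonneg_left (hd2 n) (hweight0 n)])
  have hφα : ‖φ‖ = α := tendsto_nhds_unique hφ.norm (by simpa only [hSnorm] using hlim)
  refine ⟨φ, fun x hx => hφα ▸ ?_⟩
  have happ : ∀ g : StrongDual ℝ X, g x ≤ ‖g‖ := fun g => g.apply_le_norm hx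
  have hanti : Antitone fun n => S n x + 2 * r ^ n := antitone_nat_of_succ_le fun n => by
    have h1 := mul_le_mul_of_nonneg_left ((happ (y n - w')).trans (hd2 n)) (hweight0 n)
    have h2 : S (n + 1) x = S n x + ((1 - r) * r ^ n) * (y n - w') x := by
      rw [hSs]; rfl
    rw [h2, pow_succ]
    linarith
  have hφx : Tendsto (fun n => S n x + 2 * r ^ n) atTop (𝓝 (φ x)) := by
    have h1 : Tendsto (fun n => S n x) atTop (𝓝 (φ x)) :=
      ((ContinuousLinearMap.apply ℝ ℝ x).continuous.tendsto φ).comp hφ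
    simpa using h1.add ((tendsto_pow_atTop_nhds_zero_of_lt_one hr0.le hr1).const_mul 2)
  obtain ⟨n, hn⟩ := (frequently_le_add_of_mem_limitFunctionals hw' x
    (show 0 < θ / 8 by positivity)).exists
  have h1 : φ x ≤ S (n + 1) x + 2 * r ^ (n + 1) := hanti.le_of_tendsto hφx (n + 1)
  have h2 : S (n + 1) x = S n x + ((1 - r) * r ^ n) * (y n - w') x := by
    rw [hSs]; rfl
  have h3 : S n x ≤ α * (1 - r ^ n / 2) := (happ _).trans ((hSnorm n).trans_le (hbd n))
  have hrn : 0 < r ^ n := by positivity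
  have h4 : ((1 - r) * r ^ n) * (y n - w') x ≤ r ^ n * (θ / 8) := by
    have h5 : (y n - w') x ≤ θ / 8 := by
      rw [sub_apply]
      linarith
    calc ((1 - r) * r ^ n) * (y n - w') x ≤ ((1 - r) * r ^ n) * (θ / 8) :=
          mul_le_mul_of_nonneg_left h5 (hweight0 n)
      _ ≤ r ^ n * (θ / 8) := by
          refine mul_le_mul_of_nonneg_right ?_ (by positivity)
          exact mul_le_of_le_one_left hrn.le (by linarith)
  have h6 : r ^ n * θ ≤ r ^ n * α := mul_le_mul_of_nonneg_left hα hrn.le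
  have h7 : 2 * r ^ (n + 1) = r ^ n * θ / 8 := by rw [pow_succ, hr]; ring
  have h8 : 0 < r ^ n * θ := by positivity
  linarith

end

/-- **James' theorem**: on a non-reflexive Banach space some norm-one functional does not attain
its norm. -/
theorem exists_dual_norm_eq_one_forall_norm_lt_one {𝕜 X : Type*} [RCLike 𝕜]
    [NormedAddCommGroup X] [NormedSpace 𝕜 X] [CompleteSpace X]
    (hX : ¬ Function.Surjective (NormedSpace.inclusionInDoubleDual 𝕜 X)) :
    ∃ ψ : StrongDual 𝕜 X, ‖ψ‖ = 1 ∧ ∀ x, ‖x‖ = 1 → ‖ψ x‖ < 1 := by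
  obtain ⟨c, hc, f, x, hf, hx, hlarge, hsmall⟩ :=
    exists_seq_of_not_surjective_inclusionInDoubleDual hX
  let _ : NormedSpace ℝ X := NormedSpace.restrictScalars ℝ 𝕜 X
  have : IsScalarTower ℝ 𝕜 X := IsScalarTower.of_algebraMap_smul fun _ _ => rfl
  let F : ℕ → StrongDual ℝ X := fun n => RCLike.reCLM.comp ((f n).restrictScalars ℝ)
  have hFapp : ∀ n y, F n y = RCLike.re (f n y) := fun _ _ => rfl
  have hF : ∀ n, ‖F n‖ ≤ 1 := fun n =>
    ContinuousLinearMap.opNorm_le_bound _ zero_le_one fun y => by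
      rw [hFapp, Real.norm_eq_abs]
      exact (RCLike.abs_re_le_norm _).trans ((f n).le_of_opNorm_le (hf n) y)
  obtain ⟨φ, hφ⟩ := exists_dual_forall_lt_norm hF (θ := 2 * c) (by positivity) (by
    intro w hw g hg
    have hlow : ∃ N, ∀ n ≥ N, 3 * c ≤ g (x n) := by
      have hconv : Convex ℝ {g : StrongDual ℝ X | ∃ N, ∀ n ≥ N, 3 * c ≤ g (x n)} := by
        rintro g₁ ⟨N₁, h₁⟩ g₂ ⟨N₂, h₂⟩ a b ha hb hab
        refine ⟨max N₁ N₂, fun n hn => ?_⟩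
        have k₁ := mul_le_mul_of_nonneg_left (h₁ n (le_of_max_le_left hn)) ha
        have k₂ := mul_le_mul_of_nonneg_left (h₂ n (le_of_max_le_right hn)) hb
        change 3 * c ≤ a * g₁ (x n) + b * g₂ (x n)
        calc 3 * c = a * (3 * c) + b * (3 * c) := by rw [← add_mul, hab, one_mul]
          _ ≤ _ := add_le_add k₁ k₂
      refine convexHull_min ?_ hconv hg
      rintro _ ⟨m, rfl⟩
      exact ⟨m, fun n hn => hlarge m n hn⟩
    obtain ⟨N, hN⟩ := hlow
    have hwN : w (x N) ≤ c := hw _ _ (by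
      filter_upwards [eventually_gt_atTop N] with n hn
      exact hsmall N n hn)
    have := (g - w).apply_le_norm (hx N)
    rw [sub_apply] at this
    linarith [hN N le_rfl])
  have hφpos : 0 < ‖φ‖ := by simpa using hφ 0 (by simp)
  have hnorm : ‖(φ.extendRCLike : StrongDual 𝕜 X)‖ = ‖φ‖ := StrongDual.norm_extendRCLike φ
  have hlt : ∀ y, ‖y‖ = 1 → ‖(φ.extendRCLike : StrongDual 𝕜 X) y‖ < ‖φ‖ := by
    intro y hy
    obtain ⟨a, ha, hay⟩ := RCLike.exists_norm_eq_mul_self ((φ.extendRCLike : StrongDual 𝕜 X) y)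
    have h1 := hφ (a • y) (by rw [norm_smul, ha, hy, one_mul])
    have hre : ∀ v, RCLike.re ((φ.extendRCLike : StrongDual 𝕜 X) v) = φ v := fun v => by simp
    have h2 := hre (a • y)
    rw [map_smul, smul_eq_mul, ← hay, RCLike.ofReal_re] at h2
    rwa [h2]
  refine ⟨((‖φ‖⁻¹ : ℝ) : 𝕜) • φ.extendRCLike, ?_, fun y hy => ?_⟩
  · rw [norm_smul, hnorm, RCLike.norm_ofReal, abs_of_pos (inv_pos.2 hφpos),
      inv_mul_cancel₀ hφpos.ne']
  · rw [smul_apply, norm_smul, RCLike.norm_ofReal,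
      abs_of_pos (inv_pos.2 hφpos), inv_mul_lt_one₀ hφpos]
    exact hlt y hy

/-- If `X` is a non-reflexive Banach space and `Y` is a nonzero Banach space,
then the pair `(X, Y)` fails the strong Bishop-Phelps-Bollobás property; in fact there is a
norm-one operator `T : X → Y` which does not attain its norm. -/
theorem not_reflexive_fails_sBPBp
    (𝕜 : Type*) [RCLike 𝕜]
    (X : Type*) [NormedAddCommGroup X] [NormedSpace 𝕜 X] [CompleteSpace X]
    (Y : Type*) [NormedAddCommGroup Y] [NormedSpace 𝕜 Y] [CompleteSpace Y] [Nontrivial Y]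
    (hX : ¬ Function.Surjective (NormedSpace.inclusionInDoubleDual 𝕜 X)) :
    ¬ SBPBp 𝕜 X Y ∧
      ∃ T : X →L[𝕜] Y, ‖T‖ = 1 ∧ ∀ x : X, ‖x‖ = 1 → ‖T x‖ < 1 := by
  obtain ⟨ψ, hψ, hlt⟩ := exists_dual_norm_eq_one_forall_norm_lt_one hX
  obtain ⟨y₀, hy₀⟩ := exists_ne (0 : Y)
  obtain ⟨y, hy⟩ : ∃ y : Y, ‖y‖ = 1 :=
    ⟨((‖y₀‖⁻¹ : ℝ) : 𝕜) • y₀, by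
      rw [norm_smul, RCLike.norm_ofReal, abs_of_nonneg (by positivity),
        inv_mul_cancel₀ (norm_ne_zero_iff.2 hy₀)]⟩
  have hT : ‖ψ.smulRight y‖ = 1 := by
    rw [ContinuousLinearMap.norm_smulRight_apply, hψ, hy, one_mul]
  have hTlt : ∀ x, ‖x‖ = 1 → ‖ψ.smulRight y x‖ < 1 := fun x hx => by
    rw [ContinuousLinearMap.smulRight_apply, norm_smul, hy, mul_one]
    exact hlt x hx
  refine ⟨fun h => ?_, ψ.smulRight y, hT, hTlt⟩
  obtain ⟨η, hη, hη'⟩ := h 1 one_pos _ hT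
  obtain ⟨x₀, hx₀, hx₀η⟩ : ∃ x₀ : X, ‖x₀‖ = 1 ∧ 1 - η < ‖ψ.smulRight y x₀‖ := by
    by_contra! hcon
    have h1 : ‖ψ.smulRight y‖ ≤ max (1 - η) 0 :=
      ContinuousLinearMap.opNorm_le_of_unit_norm (le_max_right _ _)
        fun x hx => (hcon x hx).trans (le_max_left _ _)
    rw [hT] at h1
    exact absurd h1 (not_le.2 (max_lt (by linarith) one_pos))
  obtain ⟨x₁, hx₁, hTx₁, -⟩ := hη' x₀ hx₀ hx₀η
  exact (hTlt x₁ hx₁).ne hTx₁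
end

section
/- For 𝕜 = ℝ or ℂ and real numbers p, q with 1 ≤ q < p < ∞, the pair (ℓ_p, ℓ_q) of scalar sequence spaces has the strong Bishop-Phelps-Bollobás property: for every ε > 0 and every bounded linear operator T : ℓ_p → ℓ_q with ‖T‖ = 1 there exists η > 0 such that whenever x₀ ∈ ℓ_p with ‖x₀‖_p = 1 satisfies ‖T x₀‖_q > 1 - η, there exists x₁ ∈ ℓ_p with ‖x₁‖_p = 1, ‖T x₁‖_q = 1 and ‖x₁ - x₀‖_p < ε. -/
open scoped ENNReal

open Filter Topology

/-- A bounded family in a proper space converges along every ultrafilter. -/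
theorem Ultrafilter.exists_tendsto_of_norm_le {ι E : Type*} [NormedAddCommGroup E]
    [ProperSpace E] (U : Ultrafilter ι) {f : ι → E} {C : ℝ} (hf : ∀ n, ‖f n‖ ≤ C) :
    ∃ a, Tendsto f U (𝓝 a) := by
  obtain ⟨a, -, ha⟩ := (isCompact_closedBall (0 : E) C).ultrafilter_le_nhds' (U.map f)
    (Filter.mem_map.2 (Filter.univ_mem' fun n => by simpa using hf n))
  exact ⟨a, ha⟩

/-- Asymptotic additivity of the `p`-th power of the norm of `ℓ_p`, for a finite part of a vector
and a coordinatewise null family. -/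
theorem lp.tendsto_norm_sum_single_add_rpow {α ι : Type*} [DecidableEq α] {E : α → Type*}
    [∀ i, NormedAddCommGroup (E i)] {p : ℝ≥0∞} (hp : 0 < p.toReal)
    {l : Filter ι} {w : ι → lp E p} {r : ℝ} (hw : ∀ i, Tendsto (fun n => w n i) l (𝓝 0))
    (hr : Tendsto (fun n => ‖w n‖) l (𝓝 r)) (x : ∀ i, E i) (s : Finset α) :
    Tendsto (fun n => ‖(∑ i ∈ s, lp.single p i (x i)) + w n‖ ^ p.toReal) l
      (𝓝 (‖∑ i ∈ s, lp.single p i (x i)‖ ^ p.toReal + r ^ p.toReal)) := by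
  have key : ∀ n, ‖(∑ i ∈ s, lp.single p i (x i)) + w n‖ ^ p.toReal =
      ∑ i ∈ s, (‖x i + w n i‖ ^ p.toReal - ‖w n i‖ ^ p.toReal) + ‖w n‖ ^ p.toReal := by
    intro n
    rw [← sub_eq_iff_eq_add]
    refine ((lp.hasSum_norm hp _).sub (lp.hasSum_norm hp (w n))).unique ?_
    have happ : ∀ i, (∑ i ∈ s, lp.single p i (x i) : lp E p) i = if i ∈ s then x i else 0 := by
      intro i
      simp only [lp.coeFn_single, lp.coeFn_sum, Finset.sum_apply, Finset.sum_pi_single]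
    have hs : ∑ i ∈ s, (‖x i + w n i‖ ^ p.toReal - ‖w n i‖ ^ p.toReal) =
        ∑ i ∈ s, (‖((∑ i ∈ s, lp.single p i (x i)) + w n : lp E p) i‖ ^ p.toReal
          - ‖w n i‖ ^ p.toReal) := by
      refine Finset.sum_congr rfl fun i hi => ?_
      rw [lp.coeFn_add, Pi.add_apply, happ, if_pos hi]
    rw [hs]
    refine hasSum_sum_of_ne_finset_zero fun i hi => ?_
    rw [lp.coeFn_add, Pi.add_apply, happ, if_neg hi, zero_add, sub_self]
  simp only [key, lp.norm_sum_single hp]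
  refine Tendsto.add (tendsto_finsetSum _ fun i _ => ?_) (hr.rpow_const (Or.inr hp.le))
  have h1 : Tendsto (fun n => ‖x i + w n i‖ ^ p.toReal) l (𝓝 (‖x i + 0‖ ^ p.toReal)) :=
    ((tendsto_const_nhds.add (hw i)).norm).rpow_const (Or.inr hp.le)
  have h2 : Tendsto (fun n => ‖w n i‖ ^ p.toReal) l (𝓝 (‖(0 : E i)‖ ^ p.toReal)) :=
    ((hw i).norm).rpow_const (Or.inr hp.le)
  simpa [Real.zero_rpow hp.ne'] using h1.sub h2

/-- Asymptotic additivity of the `p`-th power of the norm of `ℓ_p`, for a vector and a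
coordinatewise null family. -/
theorem lp.tendsto_norm_add_rpow {α ι : Type*} {E : α → Type*}
    [∀ i, NormedAddCommGroup (E i)] {p : ℝ≥0∞} [Fact (1 ≤ p)] (hp : p ≠ ∞)
    {l : Filter ι} {w : ι → lp E p} {r : ℝ} (hw : ∀ i, Tendsto (fun n => w n i) l (𝓝 0))
    (hr : Tendsto (fun n => ‖w n‖) l (𝓝 r)) (x : lp E p) :
    Tendsto (fun n => ‖x + w n‖ ^ p.toReal) l (𝓝 (‖x‖ ^ p.toReal + r ^ p.toReal)) := by
  classical
  rcases l.eq_or_neBot with rfl | hl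
  · exact tendsto_bot
  have hp0 : 0 < p.toReal :=
    ENNReal.toReal_pos (zero_lt_one.trans_le (Fact.out : 1 ≤ p)).ne' hp
  have hr0 : 0 ≤ r := ge_of_tendsto' hr fun n => norm_nonneg _
  have hz : Tendsto (fun s : Finset α => ∑ i ∈ s, lp.single p i (x i)) atTop (𝓝 x) :=
    lp.hasSum_single hp x
  have hroot : Tendsto (fun n => ‖x + w n‖) l
      (𝓝 ((‖x‖ ^ p.toReal + r ^ p.toReal) ^ p.toReal⁻¹)) := by
    refine TendstoUniformly.tendsto_of_eventually_tendsto (p := atTop)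
      (F := fun (s : Finset α) n => ‖(∑ i ∈ s, lp.single p i (x i)) + w n‖)
      (L := fun s : Finset α =>
        (‖∑ i ∈ s, lp.single p i (x i)‖ ^ p.toReal + r ^ p.toReal) ^ p.toReal⁻¹) ?_ ?_ ?_
    · rw [Metric.tendstoUniformly_iff]
      intro ε hε
      filter_upwards [Metric.tendsto_nhds.1 hz ε hε] with s hs n
      refine lt_of_le_of_lt ?_ hs
      rw [Real.dist_eq, dist_comm, dist_eq_norm]
      refine (abs_norm_sub_norm_le _ _).trans_eq ?_
      congr 1
      abel
    · refine Eventually.of_forall fun s => ?_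
      have h := (lp.tendsto_norm_sum_single_add_rpow hp0 hw hr x s).rpow_const
        (p := p.toReal⁻¹) (Or.inr (inv_nonneg.2 hp0.le))
      refine h.congr fun n => ?_
      exact Real.rpow_rpow_inv (norm_nonneg _) hp0.ne'
    · exact ((hz.norm.rpow_const (Or.inr hp0.le)).add_const _).rpow_const
        (Or.inr (inv_nonneg.2 hp0.le))
  have h := hroot.rpow_const (p := p.toReal) (Or.inr hp0.le)
  rwa [Real.rpow_inv_rpow (by positivity) hp0.ne'] at h

theorem ContinuousLinearMap.eq_zero_of_rpow_add_le {𝕜 E F : Type*} [RCLike 𝕜]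
    [NormedAddCommGroup E] [NormedSpace 𝕜 E] [NormedAddCommGroup F] [NormedSpace 𝕜 F]
    (T : E →L[𝕜] F) {p q r c : ℝ} (hq : 0 < q) (hqp : q < p) (hr : 0 ≤ r) (hc : 0 ≤ c)
    (h : ∀ x : E, ∀ t : ℝ, 0 < t →
      ‖T x‖ ^ q + t ^ q * c ≤ ‖T‖ ^ q * (‖x‖ ^ p + t ^ p * r) ^ (q / p)) : c = 0 := by
  have hp : 0 < p := hq.trans hqp
  have key : ∀ t : ℝ, 0 < t → c ≤ ‖T‖ ^ q * (q / p * r) * t ^ (p - q) := by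
    intro t ht
    set D := ‖T‖ ^ q * (1 + t ^ p * r) ^ (q / p) - t ^ q * c with hD
    have hx : ∀ x : E, ‖x‖ ≤ 1 → ‖T x‖ ^ q ≤ D := by
      intro x hx
      have h1 : ‖x‖ ^ p ≤ 1 := Real.rpow_le_one (norm_nonneg _) hx hp.le
      have h2 : ‖T‖ ^ q * (‖x‖ ^ p + t ^ p * r) ^ (q / p) ≤
          ‖T‖ ^ q * (1 + t ^ p * r) ^ (q / p) := by gcongr
      linarith [h x t ht]
    have hD0 : 0 ≤ D := by simpa [Real.zero_rpow hq.ne'] using hx 0 (by simp)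
    have hT : ‖T‖ ≤ D ^ q⁻¹ := by
      refine T.opNorm_le_of_unit_norm (by positivity) fun x h1 => ?_
      rw [Real.le_rpow_inv_iff_of_pos (norm_nonneg _) hD0 hq]
      exact hx x h1.le
    rw [Real.le_rpow_inv_iff_of_pos (norm_nonneg _) hD0 hq] at hT
    have hB : (1 + t ^ p * r) ^ (q / p) ≤ 1 + q / p * (t ^ p * r) :=
      rpow_one_add_le_one_add_mul_self (by linarith [show 0 ≤ t ^ p * r by positivity])
        (by positivity) ((div_le_one hp).2 hqp.le)
    have hB' := mul_le_mul_of_nonneg_left hB (show 0 ≤ ‖T‖ ^ q by positivity)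
    have htp : t ^ p = t ^ (p - q) * t ^ q := by
      rw [← Real.rpow_add ht]
      simp
    have htq : 0 < t ^ q := by positivity
    refine le_of_mul_le_mul_left ?_ htq
    rw [htp] at hB'
    rw [htp] at hD
    linarith
  have hlim : Tendsto (fun t : ℝ => ‖T‖ ^ q * (q / p * r) * t ^ (p - q)) (𝓝[>] 0) (𝓝 0) := by
    have h0 : Tendsto (fun t : ℝ => t ^ (p - q)) (𝓝[>] 0) (𝓝 (0 ^ (p - q))) :=
      (tendsto_id.mono_left nhdsWithin_le_nhds).rpow_const (Or.inr (sub_pos.2 hqp).le)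
    rw [Real.zero_rpow (sub_pos.2 hqp).ne'] at h0
    simpa using h0.const_mul (‖T‖ ^ q * (q / p * r))
  refine le_antisymm (ge_of_tendsto hlim ?_) hc
  filter_upwards [self_mem_nhdsWithin] with t ht using key t ht

/-- For `1 < p < ∞`, bounded coordinatewise null families in `ℓ_p` are weakly null. -/
theorem lp.tendsto_apply_zero_of_tendsto_coord {𝕜 α ι : Type*} [RCLike 𝕜] {E : α → Type*}
    [∀ i, NormedAddCommGroup (E i)] [∀ i, NormedSpace 𝕜 (E i)] {p : ℝ≥0∞} [Fact (1 ≤ p)]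
    (hp1 : 1 < p) (hp : p ≠ ∞) {U : Ultrafilter ι} {w : ι → lp E p} {C : ℝ}
    (hC : ∀ n, ‖w n‖ ≤ C) (hw : ∀ i, Tendsto (fun n => w n i) U (𝓝 0)) (f : lp E p →L[𝕜] 𝕜) :
    Tendsto (fun n => f (w n)) U (𝓝 0) := by
  have hP1 : 1 < p.toReal := by
    simpa using (ENNReal.toReal_lt_toReal ENNReal.one_ne_top hp).2 hp1
  have hP0 : 0 < p.toReal := zero_lt_one.trans hP1
  obtain ⟨r, hr⟩ := U.exists_tendsto_of_norm_le (f := fun n => ‖w n‖) (C := C)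
    (fun n => by simpa using hC n)
  have hr0 : 0 ≤ r := ge_of_tendsto' hr fun n => norm_nonneg _
  obtain ⟨c, hc⟩ := U.exists_tendsto_of_norm_le (f := fun n => f (w n)) (C := ‖f‖ * C)
    (fun n => f.le_of_opNorm_le_of_le le_rfl (hC n))
  suffices h : ‖c‖ = 0 by rwa [norm_eq_zero.1 h] at hc
  refine f.eq_zero_of_rpow_add_le (p := p.toReal) (q := 1) (r := r ^ p.toReal) one_pos hP1
    (by positivity) (norm_nonneg _) fun x t ht => ?_
  obtain ⟨u, hu, huc⟩ := RCLike.exists_norm_eq_mul_self c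
  obtain ⟨v, hv, hvx⟩ := RCLike.exists_norm_eq_mul_self (f x)
  have hnorm : ∀ y : lp E p, ‖((t : 𝕜) * u) • y‖ = t * ‖y‖ := by
    intro y
    rw [norm_smul, norm_mul, hu, RCLike.norm_ofReal, abs_of_pos ht, mul_one]
  have h1 := lp.tendsto_norm_add_rpow hp (l := (U : Filter ι))
    (w := fun n => ((t : 𝕜) * u) • w n) (r := t * r)
    (fun i => by simpa using (hw i).const_smul ((t : 𝕜) * u))
    (by simpa only [hnorm] using hr.const_mul t) (v • x)
  have h2 := (h1.rpow_const (p := 1 / p.toReal) (Or.inr (by positivity))).const_mul ‖f‖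
  have h3 : Tendsto (fun n => ‖f (v • x + ((t : 𝕜) * u) • w n)‖) U (𝓝 (‖f x‖ + t * ‖c‖)) := by
    have h4 : Tendsto (fun n => f (v • x + ((t : 𝕜) * u) • w n)) U
        (𝓝 (v * f x + (t : 𝕜) * u * c)) := by
      simpa using (hc.const_mul ((t : 𝕜) * u)).const_add (v * f x)
    have h5 : ‖v * f x + (t : 𝕜) * u * c‖ = ‖f x‖ + t * ‖c‖ := by
      rw [← hvx, mul_assoc, ← huc, ← RCLike.ofReal_mul, ← RCLike.ofReal_add, RCLike.norm_ofReal,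
        abs_of_nonneg (by positivity)]
    rw [← h5]
    exact h4.norm
  have h6 := le_of_tendsto_of_tendsto' h3 h2 fun n => by
    rw [one_div, Real.rpow_rpow_inv (norm_nonneg _) hP0.ne']
    exact f.le_opNorm _
  rw [norm_smul, hv, one_mul, Real.mul_rpow ht.le hr0] at h6
  simpa only [Real.rpow_one] using h6

/-- **Pitt's theorem**: for `1 ≤ q < p < ∞`, operators from `ℓ_p` to `ℓ_q` map bounded
coordinatewise null families to norm null ones. -/
theorem lp.tendsto_clm_apply_zero_of_tendsto_coord {𝕜 α β ι : Type*} [RCLike 𝕜] {E : α → Type*}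
    [∀ i, NormedAddCommGroup (E i)] [∀ i, NormedSpace 𝕜 (E i)] {p q : ℝ≥0∞} [Fact (1 ≤ p)]
    [Fact (1 ≤ q)] (hqp : q < p) (hp : p ≠ ∞) {U : Ultrafilter ι} {w : ι → lp E p} {C : ℝ}
    (hC : ∀ n, ‖w n‖ ≤ C) (hw : ∀ i, Tendsto (fun n => w n i) U (𝓝 0))
    (T : lp E p →L[𝕜] lp (fun _ : β => 𝕜) q) :
    Tendsto (fun n => T (w n)) U (𝓝 0) := by
  have hq1 : 1 ≤ q := Fact.out
  have hQP : q.toReal < p.toReal := (ENNReal.toReal_lt_toReal hqp.ne_top hp).2 hqp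
  have hQ0 : 0 < q.toReal := ENNReal.toReal_pos (zero_lt_one.trans_le hq1).ne' hqp.ne_top
  have hP0 : 0 < p.toReal := hQ0.trans hQP
  have hTw : ∀ j, Tendsto (fun n => T (w n) j) U (𝓝 0) := fun j =>
    lp.tendsto_apply_zero_of_tendsto_coord (hq1.trans_lt hqp) hp hC hw
      ((lp.evalCLM 𝕜 (fun _ : β => 𝕜) q j).comp T)
  obtain ⟨r, hr⟩ := U.exists_tendsto_of_norm_le (f := fun n => ‖w n‖) (C := C)
    (fun n => by simpa using hC n)
  have hr0 : 0 ≤ r := ge_of_tendsto' hr fun n => norm_nonneg _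
  obtain ⟨c, hc⟩ := U.exists_tendsto_of_norm_le (f := fun n => ‖T (w n)‖) (C := ‖T‖ * C)
    (fun n => by simpa using T.le_of_opNorm_le_of_le le_rfl (hC n))
  have hc0 : 0 ≤ c := ge_of_tendsto' hc fun n => norm_nonneg _
  suffices h : c ^ q.toReal = 0 by
    rw [Real.rpow_eq_zero hc0 hQ0.ne'] at h
    rw [tendsto_zero_iff_norm_tendsto_zero]
    rwa [h] at hc
  refine T.eq_zero_of_rpow_add_le (p := p.toReal) (q := q.toReal) (r := r ^ p.toReal) hQ0 hQP
    (by positivity) (by positivity) fun x t ht => ?_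
  have hnorm : ∀ y : lp E p, ‖(t : 𝕜) • y‖ = t * ‖y‖ := by
    intro y
    rw [norm_smul, RCLike.norm_ofReal, abs_of_pos ht]
  have hnorm' : ∀ y : lp (fun _ : β => 𝕜) q, ‖(t : 𝕜) • y‖ = t * ‖y‖ := by
    intro y
    rw [norm_smul, RCLike.norm_ofReal, abs_of_pos ht]
  have h1 := lp.tendsto_norm_add_rpow hp (l := (U : Filter ι))
    (w := fun n => (t : 𝕜) • w n) (r := t * r)
    (fun i => by simpa using (hw i).const_smul (t : 𝕜))
    (by simpa only [hnorm] using hr.const_mul t) x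
  have h2 := (h1.rpow_const (p := q.toReal / p.toReal) (Or.inr (by positivity))).const_mul
    (‖T‖ ^ q.toReal)
  have h3 := lp.tendsto_norm_add_rpow hqp.ne_top (l := (U : Filter ι))
    (w := fun n => (t : 𝕜) • T (w n)) (r := t * c)
    (fun i => by simpa [RCLike.real_smul_eq_coe_mul] using (hTw i).const_smul (t : 𝕜))
    (by simpa only [hnorm'] using hc.const_mul t) (T x)
  have h6 := le_of_tendsto_of_tendsto' h3 h2 fun n => by
    rw [← Real.rpow_mul (norm_nonneg _), mul_div_cancel₀ _ hP0.ne',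
      ← Real.mul_rpow (norm_nonneg _) (norm_nonneg _), ← map_smul, ← map_add]
    gcongr
    exact T.le_opNorm _
  rwa [Real.mul_rpow ht.le hr0, Real.mul_rpow ht.le hc0] at h6

/-- For `1 ≤ q < p < ∞` the pair `(ℓ_p, ℓ_q)` of scalar sequence spaces has
the strong Bishop-Phelps-Bollobás property. -/
theorem lp_lq_sBPBp_of_lt
    (𝕜 : Type*) [RCLike 𝕜] (p q : ℝ≥0∞) [Fact (1 ≤ p)] [Fact (1 ≤ q)]
    (hq : 1 ≤ q) (hqp : q < p) (hp : p < ∞) :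
    ∀ ε : ℝ, 0 < ε → ∀ T : lp (fun _ : ℕ => 𝕜) p →L[𝕜] lp (fun _ : ℕ => 𝕜) q, ‖T‖ = 1 →
      ∃ η : ℝ, 0 < η ∧ ∀ x₀ : lp (fun _ : ℕ => 𝕜) p, ‖x₀‖ = 1 → 1 - η < ‖T x₀‖ →
        ∃ x₁ : lp (fun _ : ℕ => 𝕜) p, ‖x₁‖ = 1 ∧ ‖T x₁‖ = 1 ∧ ‖x₁ - x₀‖ < ε := by
  intro ε hε T hT
  by_contra! hcon
  have hp0 : p ≠ 0 := (zero_lt_one.trans_le (hq.trans hqp.le)).ne'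
  have hP0 : 0 < p.toReal := ENNReal.toReal_pos hp0 hp.ne
  choose x hx1 hxT hxε using fun n : ℕ => hcon (1 / ((n : ℝ) + 1)) Nat.one_div_pos_of_nat
  let U : Ultrafilter ℕ := hyperfilter ℕ
  have hU : (U : Filter ℕ) ≤ atTop := Nat.hyperfilter_le_atTop
  choose y hy using fun i => U.exists_tendsto_of_norm_le (f := fun n => x n i) (C := 1)
    (fun n => (lp.norm_apply_le_norm hp0 (x n) i).trans (hx1 n).le)
  have hy' : Tendsto (fun n i => x n i) U (𝓝 y) := tendsto_pi_nhds.2 hy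
  have hmem : Memℓp y p := lp.memℓp_of_tendsto (F := x) (l := (U : Filter ℕ))
    (isBounded_iff_forall_norm_le.2 ⟨1, by rintro _ ⟨n, rfl⟩; exact (hx1 n).le⟩) hy'
  let z : lp (fun _ : ℕ => 𝕜) p := ⟨y, hmem⟩
  have hz : ‖z‖ ≤ 1 := lp.norm_le_of_tendsto (F := x) (l := (U : Filter ℕ))
    (Eventually.of_forall fun n => (hx1 n).le) hy'
  have hw : ∀ i, Tendsto (fun n => (x n - z) i) U (𝓝 0) := fun i => by
    simpa using (hy i).sub_const (y i)
  have hC : ∀ n, ‖x n - z‖ ≤ 1 + 1 := fun n =>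
    (norm_sub_le _ _).trans (add_le_add (hx1 n).le hz)
  have hTw := lp.tendsto_clm_apply_zero_of_tendsto_coord hqp hp.ne hC hw T
  have hTx : Tendsto (fun n => ‖T (x n)‖) U (𝓝 ‖T z‖) := by
    simpa using (hTw.add_const (T z)).norm
  have hTx1 : Tendsto (fun n => ‖T (x n)‖) U (𝓝 1) := by
    have h0 : Tendsto (fun n : ℕ => 1 - 1 / ((n : ℝ) + 1)) U (𝓝 1) := by
      simpa using (tendsto_one_div_add_atTop_nhds_zero_nat (𝕜 := ℝ).mono_left hU).const_sub 1
    refine tendsto_of_tendsto_of_tendsto_of_le_of_le h0 tendsto_const_nhds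
      (fun n => (hxT n).le) fun n => ?_
    simpa [hT, hx1] using T.le_opNorm (x n)
  have hTz : ‖T z‖ = 1 := tendsto_nhds_unique hTx hTx1
  have hz1 : ‖z‖ = 1 := by
    refine le_antisymm hz ?_
    simpa [hT, hTz] using T.le_opNorm z
  obtain ⟨r, hr⟩ := U.exists_tendsto_of_norm_le (f := fun n => ‖x n - z‖) (C := 1 + 1)
    (fun n => by simpa using hC n)
  have hr0 : 0 ≤ r := ge_of_tendsto' hr fun n => norm_nonneg _
  have hadd := lp.tendsto_norm_add_rpow hp.ne hw hr z
  simp only [add_sub_cancel, hx1, hz1, Real.one_rpow] at hadd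
  have hr1 : r ^ p.toReal = 0 := by
    linarith [tendsto_nhds_unique hadd tendsto_const_nhds]
  rw [Real.rpow_eq_zero hr0 hP0.ne'] at hr1
  have hεr : ε ≤ r := ge_of_tendsto' hr fun n => by
    rw [norm_sub_rev]
    exact hxε n z hz1 hTz
  linarith
end
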